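/- arXiv:1302.0073 — 2 statements merged into one kernel-verified Lean document; each statement's English description precedes it below -/
import Mathlib

section
/- For all non-negative integers n and j, one has (n+1)^j · H({1}^j; n) + Σ_{i=j}^{n} (−1)^{n+i+1} · binom(i, j) · (n+1)^i · H({1}^i; n) = 0. -/
open Finset Polynomial

/-- The multiple harmonic sum `H({1}^j; m)`: the `j`-th elementary symmetric
polynomial evaluated at `1, 1/2, ..., 1/m`. -/
noncomputable def mhs (j m : ℕ) : ℚ :=
  ∑ s ∈ Finset.powersetCard j (Finset.Icc 1 m), ∏ i ∈ s, (1 : ℚ) / i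

theorem prod_one_add_C_mul_eq_sum_mhs (n : ℕ) (a : ℚ) (y : ℚ[X]) :
    ∏ k ∈ Finset.Icc 1 n, (1 + C (a / k) * y) =
      ∑ i ∈ Finset.range (n + 1), C (a ^ i * mhs i n) * y ^ i := by
  rw [Finset.prod_one_add, Finset.sum_powerset]
  simp only [Nat.card_Icc, Nat.add_sub_cancel]
  refine Finset.sum_congr rfl fun i _ => ?_
  rw [mhs, Finset.mul_sum, map_sum, Finset.sum_mul]
  refine Finset.sum_congr rfl fun s hs => ?_
  rw [Finset.prod_mul_distrib, Finset.prod_const, (Finset.mem_powersetCard.mp hs).2, ← map_prod]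
  congr 2
  rw [← (Finset.mem_powersetCard.mp hs).2, ← Finset.prod_const, ← Finset.prod_mul_distrib]
  exact Finset.prod_congr rfl fun k _ => by ring

theorem prod_Icc_reflect {M : Type*} [CommMonoid M] (n : ℕ) (f : ℕ → M) :
    ∏ k ∈ Finset.Icc 1 n, f (n + 1 - k) = ∏ k ∈ Finset.Icc 1 n, f k := by
  refine Finset.prod_nbij' (fun k => n + 1 - k) (fun k => n + 1 - k) ?_ ?_ ?_ ?_ fun _ _ => rfl <;>
    · intro k hk
      simp only [Finset.mem_Icc] at hk ⊢
      omega

theorem prod_one_add_C_mul_neg_one_sub_X (n : ℕ) :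
    ∏ k ∈ Finset.Icc 1 n, (1 + C (((n : ℚ) + 1) / k) * (-(X + 1))) =
      C ((-1 : ℚ) ^ n) * ∏ k ∈ Finset.Icc 1 n, (1 + C (((n : ℚ) + 1) / k) * X) := by
  have hfactor : ∀ k ∈ Finset.Icc 1 n, (1 + C (((n : ℚ) + 1) / k) * (-(X + 1)) : ℚ[X]) =
      C (-1 * (((n + 1 - k : ℕ) : ℚ) / k)) *
        (1 + C (((n : ℚ) + 1) / ((n + 1 - k : ℕ) : ℚ)) * X) := by
    intro k hk
    rw [Finset.mem_Icc] at hk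
    have hk0 : (k : ℚ) ≠ 0 := by
      norm_cast
      omega
    have hr0 : ((n + 1 - k : ℕ) : ℚ) ≠ 0 := by
      norm_cast
      omega
    have hr : ((n + 1 - k : ℕ) : ℚ) = n + 1 - k := by
      rw [Nat.cast_sub (by omega)]
      push_cast
      rfl
    have h₁ : (-1 * (((n + 1 - k : ℕ) : ℚ) / k)) = 1 - ((n : ℚ) + 1) / k := by
      rw [hr]
      field_simp
      ring
    have h₂ : (-1 * (((n + 1 - k : ℕ) : ℚ) / k)) * (((n : ℚ) + 1) / ((n + 1 - k : ℕ) : ℚ)) =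
        -(((n : ℚ) + 1) / k) := by
      field_simp
    rw [mul_add, mul_one, ← mul_assoc, ← C_mul, h₂, h₁, C_sub, C_neg, C_1]
    ring
  have hscalar : ∏ k ∈ Finset.Icc 1 n, (-1 * (((n + 1 - k : ℕ) : ℚ) / k)) = (-1) ^ n := by
    have hne : ∏ k ∈ Finset.Icc 1 n, (k : ℚ) ≠ 0 := by
      refine Finset.prod_ne_zero_iff.mpr fun k hk => ?_
      rw [Finset.mem_Icc] at hk
      norm_cast
      omega
    rw [Finset.prod_mul_distrib, Finset.prod_div_distrib,
      prod_Icc_reflect n (fun k => (k : ℚ)), div_self hne]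
    simp
  rw [Finset.prod_congr rfl hfactor, Finset.prod_mul_distrib, ← map_prod, hscalar,
    prod_Icc_reflect n (fun k => (1 + C (((n : ℚ) + 1) / k) * X : ℚ[X]))]

theorem stmt7 (n j : ℕ) :
    ((n : ℚ) + 1) ^ j * mhs j n +
      ∑ i ∈ Finset.Icc j n,
        (-1 : ℚ) ^ (n + i + 1) * (i.choose j : ℚ) * ((n : ℚ) + 1) ^ i * mhs i n = 0 := by
  have hcoeff := congrArg (fun p : ℚ[X] => p.coeff j) (prod_one_add_C_mul_neg_one_sub_X n)
  simp only [prod_one_add_C_mul_eq_sum_mhs, finsetSum_coeff, coeff_C_mul, neg_pow (X + 1 : ℚ[X]),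
    coeff_X_pow] at hcoeff
  have hsign : ∀ i, ((-1 : ℚ[X]) ^ i * (X + 1) ^ i).coeff j = (-1) ^ i * (i.choose j : ℚ) := by
    intro i
    rw [← coeff_X_add_one_pow ℚ i j, ← coeff_C_mul]
    simp
  have hmhs : (if j ∈ Finset.range (n + 1) then ((n : ℚ) + 1) ^ j * mhs j n else 0) =
      ((n : ℚ) + 1) ^ j * mhs j n := by
    split_ifs with h
    · rfl
    · have hj : n < j := by simpa using h
      rw [mhs, Finset.powersetCard_eq_empty.mpr (by simpa using hj)]
      simp
  have hsum : ∑ i ∈ Finset.Icc j n,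
        (-1 : ℚ) ^ (n + i + 1) * (i.choose j : ℚ) * ((n : ℚ) + 1) ^ i * mhs i n =
      ∑ i ∈ Finset.range (n + 1),
        (-1 : ℚ) ^ (n + i + 1) * (i.choose j : ℚ) * ((n : ℚ) + 1) ^ i * mhs i n := by
    refine Finset.sum_subset (fun i hi => ?_) fun i hi hi' => ?_
    · simp only [Finset.mem_Icc, Finset.mem_range] at hi ⊢
      omega
    · simp only [Finset.mem_Icc, Finset.mem_range] at hi hi'
      rw [Nat.choose_eq_zero_of_lt (by omega)]
      simp
  simp only [hsign, mul_ite, mul_one, mul_zero, Finset.sum_ite_eq, hmhs] at hcoeff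
  have hsq : (-1 : ℚ) ^ n * (-1) ^ n = 1 := by
    rw [← mul_pow]
    simp
  have hpull : ∑ i ∈ Finset.range (n + 1),
        (-1 : ℚ) ^ (n + i + 1) * (i.choose j : ℚ) * ((n : ℚ) + 1) ^ i * mhs i n =
      -(-1) ^ n * ∑ i ∈ Finset.range (n + 1),
        ((n : ℚ) + 1) ^ i * mhs i n * ((-1) ^ i * (i.choose j : ℚ)) := by
    rw [Finset.mul_sum]
    exact Finset.sum_congr rfl fun i _ => by ring
  rw [hsum, hpull, hcoeff]
  linear_combination (-(((n : ℚ) + 1) ^ j * mhs j n)) * hsq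
end

section
/- Let k be an integer, let c_0, c_1, c_2, ... be rational numbers, and for each j ≥ 0 define b_j := (k−1)^j + c_j + (−1)^{j+1} Σ_{i=0}^{j} binom(j, i)·c_i. Let p be an odd prime such that every c_i has p-adic valuation ≥ 0, and let N be an odd integer with 1 ≤ N ≤ p−4. Set E_N := binom(kp−1, p−1) − Σ_{j=0}^{N} b_j · p^j · H({1}^j; p−1). Then the p-adic valuation of E_N − ( (−B_{p−2−N}/(N+2)) · b_{N+1} · p^{N+2} ) is at least N+3. -/
open Finset Polynomial

/-- The rational `x` lies in `p ^ n` times the ring of `p`-integral rationals. -/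
def PadicDvd (p n : ℕ) (x : ℚ) : Prop :=
  padicNorm p x ≤ (p : ℚ) ^ (-(n : ℤ))

namespace PadicDvd

variable {p : ℕ} [hp : Fact p.Prime] {m n : ℕ} {x y : ℚ}

theorem add (hx : PadicDvd p n x) (hy : PadicDvd p n y) : PadicDvd p n (x + y) :=
  padicNorm.nonarchimedean.trans (max_le hx hy)

theorem sub (hx : PadicDvd p n x) (hy : PadicDvd p n y) : PadicDvd p n (x - y) :=
  padicNorm.sub.trans (max_le hx hy)

theorem sum {ι : Type*} {s : Finset ι} {f : ι → ℚ} (h : ∀ i ∈ s, PadicDvd p n (f i)) :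
    PadicDvd p n (∑ i ∈ s, f i) :=
  padicNorm.sum_le' h (by positivity)

theorem mul (hx : PadicDvd p m x) (hy : PadicDvd p n y) : PadicDvd p (m + n) (x * y) := by
  have hp0 : (p : ℚ) ≠ 0 := mod_cast hp.out.ne_zero
  unfold PadicDvd at *
  rw [padicNorm.mul, Nat.cast_add, neg_add, zpow_add₀ hp0]
  exact mul_le_mul hx hy (padicNorm.nonneg _) (by positivity)

theorem mul_left (hx : PadicDvd p 0 x) (hy : PadicDvd p n y) : PadicDvd p n (x * y) := by
  simpa using hx.mul hy

theorem mul_right (hx : PadicDvd p n x) (hy : PadicDvd p 0 y) : PadicDvd p n (x * y) := by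
  simpa using hx.mul hy

theorem mono (hx : PadicDvd p n x) (h : m ≤ n) : PadicDvd p m x := by
  refine hx.trans (zpow_le_zpow_right₀ ?_ (by omega))
  exact_mod_cast hp.out.one_le

theorem intCast (z : ℤ) : PadicDvd p 0 z := by
  simpa [PadicDvd] using padicNorm.of_int z

theorem natCast (a : ℕ) : PadicDvd p 0 a := mod_cast intCast (a : ℤ)

theorem one : PadicDvd p 0 1 := mod_cast natCast (p := p) 1

theorem prod {ι : Type*} {s : Finset ι} {f : ι → ℚ} (h : ∀ i ∈ s, PadicDvd p 0 (f i)) :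
    PadicDvd p 0 (∏ i ∈ s, f i) :=
  Finset.prod_induction f (PadicDvd p 0) (fun _ _ hx hy ↦ hx.mul hy) one h

theorem pow (hx : PadicDvd p 0 x) (k : ℕ) : PadicDvd p 0 (x ^ k) := by
  simpa using prod (s := Finset.range k) (f := fun _ ↦ x) fun _ _ ↦ hx

theorem prime_pow (n : ℕ) : PadicDvd p n ((p : ℚ) ^ n) := by
  have h := (padicNorm.dvd_iff_norm_le (p := p) (n := n) (z := ((p ^ n : ℕ) : ℤ))).1 dvd_rfl
  simpa [PadicDvd] using h

theorem prime : PadicDvd p 1 (p : ℚ) := by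
  simpa using prime_pow (p := p) 1

theorem inv_natCast {a : ℕ} (ha : 0 < a) (hap : a < p) : PadicDvd p 0 ((a : ℚ)⁻¹) := by
  have h := (padicNorm.nat_eq_one_iff (p := p) a).2 (Nat.not_dvd_of_pos_of_lt ha hap)
  rw [PadicDvd, inv_eq_one_div, padicNorm.div, h]
  simp

theorem of_natCast_mul {a : ℕ} (ha : 0 < a) (hap : a < p) (h : PadicDvd p n (a * x)) :
    PadicDvd p n x := by
  have ha0 : (a : ℚ) ≠ 0 := mod_cast ha.ne'
  simpa [ha0] using (inv_natCast ha hap).mul_left h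

theorem of_padicValRat_nonneg (h : 0 ≤ padicValRat p x) : PadicDvd p 0 x := by
  rcases eq_or_ne x 0 with rfl | hx
  · simp [PadicDvd]
  · rw [PadicDvd, padicNorm.eq_zpow_of_nonzero hx]
    exact zpow_le_zpow_right₀ (mod_cast hp.out.one_le) (by simpa using h)

theorem neg_one_pow (k : ℕ) : PadicDvd p 0 ((-1 : ℚ) ^ k) :=
  pow (mod_cast intCast (p := p) (-1)) k

theorem bernoulli' (h : n + 2 ≤ p) : PadicDvd p 0 (_root_.bernoulli' n) := by
  induction n using Nat.strong_induction_on with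
  | _ n ih =>
    rw [bernoulli'_def]
    refine one.sub (sum fun k hk ↦ ?_)
    have hk := Finset.mem_range.1 hk
    have hinv := inv_natCast (p := p) (a := n - k + 1) (by omega) (by omega)
    rw [Nat.cast_add, Nat.cast_sub hk.le, Nat.cast_one] at hinv
    rw [div_eq_mul_inv]
    exact ((natCast _).mul hinv).mul (ih k hk (by omega))

theorem bernoulli (h : n + 2 ≤ p) : PadicDvd p 0 (_root_.bernoulli n) := by
  rw [_root_.bernoulli]
  exact (neg_one_pow n).mul (bernoulli' h)

theorem sum_pow_sub_bernoulli (h : n + 2 ≤ p) :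
    PadicDvd p 2 (∑ i ∈ Finset.range p, (i : ℚ) ^ n - p * _root_.bernoulli n) := by
  have hn : (n : ℚ) + 1 ≠ 0 := by positivity
  have hlast : _root_.bernoulli n * ((n + 1).choose n : ℚ) * (p : ℚ) ^ (n + 1 - n) / (n + 1) =
      p * _root_.bernoulli n := by
    rw [Nat.choose_succ_self_right, Nat.add_sub_cancel_left]
    push_cast
    field_simp
  rw [sum_range_pow, Finset.sum_range_succ, hlast, add_sub_cancel_right]
  refine sum fun i hi ↦ ?_
  have hi := Finset.mem_range.1 hi
  have hinv := inv_natCast (p := p) (a := n + 1) (by omega) (by omega)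
  push_cast at hinv
  rw [div_eq_mul_inv]
  exact ((((bernoulli (by omega)).mul (natCast _)).mul_left
    ((prime_pow _).mono (by omega))).mul_right hinv)

theorem sum_pow (h : n + 2 ≤ p) : PadicDvd p 1 (∑ i ∈ Finset.range p, (i : ℚ) ^ n) := by
  simpa using ((sum_pow_sub_bernoulli h).mono one_le_two).add
    (prime.mul_right (bernoulli h))

end PadicDvd

theorem sum_Icc_pow_eq_sum_range_pow {n p : ℕ} (hn : 0 < n) (hp : 0 < p) :
    ∑ i ∈ Finset.Icc 1 (p - 1), (i : ℚ) ^ n = ∑ i ∈ Finset.range p, (i : ℚ) ^ n := by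
  obtain ⟨q, rfl⟩ := Nat.exists_eq_add_of_lt hp
  rw [Finset.range_eq_Ico, Finset.sum_eq_sum_Ico_succ_bot (by omega)]
  simp [hn.ne', Finset.Ico_add_one_right_eq_Icc]

/-- Newton's identity for a family indexed by a finset. -/
theorem sum_pow_eq_mul_esymm_sub_sum {ι R : Type*} [CommRing R] (s : Finset ι) (f : ι → R)
    {k : ℕ} (hk : 0 < k) :
    ∑ i ∈ s, f i ^ k = (-1) ^ (k + 1) * k * (s.val.map f).esymm k -
      ∑ a ∈ Finset.HasAntidiagonal.antidiagonal k with a.1 ∈ Set.Ioo 0 k,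
        (-1) ^ a.1 * (s.val.map f).esymm a.1 * ∑ i ∈ s, f i ^ a.2 := by
  have hmap : (Finset.univ : Finset s).val.map (fun i : s ↦ f i) = s.val.map f :=
    Multiset.attach_map_val' s.val f
  have hpsum (n : ℕ) :
      MvPolynomial.aeval (fun i : s ↦ f i) (MvPolynomial.psum s R n) = ∑ i ∈ s, f i ^ n := by
    simp only [MvPolynomial.psum, map_sum, map_pow, MvPolynomial.aeval_X]
    exact Finset.sum_coe_sort s fun i ↦ f i ^ n
  have h := congrArg (MvPolynomial.aeval fun i : s ↦ f i)
    (MvPolynomial.psum_eq_mul_esymm_sub_sum s R k hk)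
  simpa only [map_sub, map_mul, map_pow, map_neg, map_one, map_sum, map_natCast, hpsum,
    MvPolynomial.aeval_esymm_eq_multiset_esymm, hmap] using h

theorem sum_powersetCard_prod_inv_mul_prod {ι K : Type*} [DecidableEq ι] [Field K] (s : Finset ι)
    (f : ι → K) (hf : ∀ i ∈ s, f i ≠ 0) {j : ℕ} (hj : j ≤ s.card) :
    (∑ t ∈ Finset.powersetCard j s, ∏ i ∈ t, 1 / f i) * ∏ i ∈ s, f i =
      (s.val.map f).esymm (s.card - j) := by
  rw [Finset.esymm_map_val, Finset.sum_mul]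
  refine Finset.sum_nbij' (s \ ·) (s \ ·) ?_ ?_ ?_ ?_ ?_
  · intro t ht
    obtain ⟨hts, hcard⟩ := Finset.mem_powersetCard.1 ht
    exact Finset.mem_powersetCard.2 ⟨Finset.sdiff_subset, by
      rw [Finset.card_sdiff_of_subset hts, hcard]⟩
  · intro t ht
    obtain ⟨hts, hcard⟩ := Finset.mem_powersetCard.1 ht
    exact Finset.mem_powersetCard.2 ⟨Finset.sdiff_subset, by
      rw [Finset.card_sdiff_of_subset hts, hcard]; omega⟩
  · exact fun t ht ↦ Finset.sdiff_sdiff_eq_self (Finset.mem_powersetCard.1 ht).1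
  · exact fun t ht ↦ Finset.sdiff_sdiff_eq_self (Finset.mem_powersetCard.1 ht).1
  · intro t ht
    have hts := (Finset.mem_powersetCard.1 ht).1
    have ht0 : ∏ i ∈ t, f i ≠ 0 := Finset.prod_ne_zero_iff.2 fun i hi ↦ hf i (hts hi)
    rw [← Finset.prod_sdiff hts, Finset.prod_div_distrib, Finset.prod_const_one]
    field_simp

theorem prod_Icc_one_add_div_eq_sum_mhs (m : ℕ) (x : ℚ) :
    ∏ i ∈ Finset.Icc 1 m, (1 + x / i) = ∑ j ∈ Finset.range (m + 1), mhs j m * x ^ j := by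
  rw [Finset.prod_one_add, Finset.sum_powerset, Nat.card_Icc, Nat.add_sub_cancel]
  refine Finset.sum_congr rfl fun j _ ↦ ?_
  rw [mhs, Finset.sum_mul]
  refine Finset.sum_congr rfl fun t ht ↦ ?_
  rw [← (Finset.mem_powersetCard.1 ht).2, ← Finset.prod_const, ← Finset.prod_mul_distrib]
  exact Finset.prod_congr rfl fun i _ ↦ by ring

theorem prod_Icc_one_add_mul_div_reflect {p : ℕ} (hodd : Odd p) (x : ℚ) :
    ∏ i ∈ Finset.Icc 1 (p - 1), (1 + (-1 - x) * p / i) =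
      ∏ i ∈ Finset.Icc 1 (p - 1), (1 + x * p / i) := by
  have hreflect {M : Type} [CommMonoid M] (f : ℕ → M) :
      ∏ i ∈ Finset.Icc 1 (p - 1), f (p - i) = ∏ i ∈ Finset.Icc 1 (p - 1), f i := by
    refine Finset.prod_nbij' (p - ·) (p - ·) ?_ ?_ ?_ ?_ ?_ <;> intro i hi <;>
      simp only [Finset.mem_Icc] at hi ⊢ <;> omega
  have hne (i : ℕ) (hi : i ∈ Finset.Icc 1 (p - 1)) : (i : ℚ) ≠ 0 := by
    have := (Finset.mem_Icc.1 hi).1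
    positivity
  have hprod (y : ℚ) : ∏ i ∈ Finset.Icc 1 (p - 1), (1 + y * p / i) =
      (∏ i ∈ Finset.Icc 1 (p - 1), (i + y * p)) / ∏ i ∈ Finset.Icc 1 (p - 1), (i : ℚ) := by
    rw [← Finset.prod_div_distrib]
    refine Finset.prod_congr rfl fun i hi ↦ ?_
    have := hne i hi
    field_simp
  have hsign : (-1 : ℚ) ^ (p - 1) = 1 := (Nat.Odd.sub_odd hodd odd_one).neg_one_pow
  rw [hprod, hprod, ← hreflect fun i ↦ (i : ℚ) + (-1 - x) * p]
  congr 1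
  calc ∏ i ∈ Finset.Icc 1 (p - 1), (((p - i : ℕ) : ℚ) + (-1 - x) * p)
      = ∏ i ∈ Finset.Icc 1 (p - 1), (-1) * ((i : ℚ) + x * p) := by
        refine Finset.prod_congr rfl fun i hi ↦ ?_
        have := (Finset.mem_Icc.1 hi).2
        rw [Nat.cast_sub (by omega)]
        ring
    _ = ∏ i ∈ Finset.Icc 1 (p - 1), ((i : ℚ) + x * p) := by
        rw [Finset.prod_mul_distrib, Finset.prod_const, Nat.card_Icc, Nat.add_sub_cancel, hsign,
          one_mul]

theorem choose_mul_prime_sub_one {p : ℕ} (hodd : Odd p) (x : ℚ) :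
    Ring.choose (x * p - 1) (p - 1) = ∏ i ∈ Finset.Icc 1 (p - 1), (1 + (x - 1) * p / i) := by
  have hp : 0 < p := hodd.pos
  have hshift (f : ℕ → ℚ) : ∏ i ∈ Finset.Icc 1 (p - 1), f i =
      ∏ j ∈ Finset.range (p - 1), f (j + 1) := by
    rw [Finset.range_eq_Ico, Finset.prod_Ico_add' f 0 (p - 1) 1, zero_add,
      Finset.Ico_add_one_right_eq_Icc]
  have hsign : (-1 : ℚ) ^ (p - 1) = 1 := (Nat.Odd.sub_odd hodd odd_one).neg_one_pow
  have hfact : ((p - 1).factorial : ℚ) = ∏ j ∈ Finset.range (p - 1), ((j : ℚ) + 1) := by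
    rw [← Finset.prod_range_add_one_eq_factorial]
    push_cast
    rfl
  have hprod : Ring.choose (x * p - 1) (p - 1) =
      ∏ j ∈ Finset.range (p - 1), -(1 + (-x) * p / ((j : ℚ) + 1)) := by
    rw [Ring.choose_eq_smul, ← Polynomial.aeval_eq_smeval, Polynomial.aeval_def,
      ← Polynomial.eval_map, descPochhammer_map, descPochhammer_eval_eq_prod_range, hfact,
      smul_eq_mul, ← Finset.prod_inv_distrib, ← Finset.prod_mul_distrib]
    refine Finset.prod_congr rfl fun j _ ↦ ?_
    have : (j : ℚ) + 1 ≠ 0 := by positivity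
    field_simp
    ring
  rw [← prod_Icc_one_add_mul_div_reflect hodd, hshift, hprod, Finset.prod_neg, Finset.card_range,
    hsign, one_mul]
  refine Finset.prod_congr rfl fun j _ ↦ ?_
  push_cast
  ring

theorem sum_mhs_mul_binomial_transform {p : ℕ} (hodd : Odd p) (c : ℕ → ℚ) :
    ∑ j ∈ Finset.range p, mhs j (p - 1) * (p : ℚ) ^ j *
        ((-1) ^ j * ∑ i ∈ Finset.range (j + 1), (j.choose i : ℚ) * c i) =
      ∑ i ∈ Finset.range p, mhs i (p - 1) * (p : ℚ) ^ i * c i := by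
  have hp : p - 1 + 1 = p := Nat.sub_add_cancel hodd.pos
  have hpoly : ∑ j ∈ Finset.range p, C (mhs j (p - 1) * (p : ℚ) ^ j * (-1) ^ j) * (1 + X) ^ j =
      ∑ j ∈ Finset.range p, C (mhs j (p - 1) * (p : ℚ) ^ j) * X ^ j := by
    refine Polynomial.funext fun x ↦ ?_
    have h := prod_Icc_one_add_mul_div_reflect hodd x
    rw [prod_Icc_one_add_div_eq_sum_mhs, prod_Icc_one_add_div_eq_sum_mhs, hp] at h
    simp only [Polynomial.eval_finsetSum, Polynomial.eval_mul, Polynomial.eval_C,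
      Polynomial.eval_pow, Polynomial.eval_add, Polynomial.eval_one, Polynomial.eval_X]
    convert h using 2 with j _ j _
    · rw [show (-1 - x) * (p : ℚ) = p * (-1 * (1 + x)) by ring, mul_pow, mul_pow]
      ring
    · rw [mul_pow]
      ring
  have hcoeff (i : ℕ) (hi : i ∈ Finset.range p) :
      ∑ j ∈ Finset.range p, mhs j (p - 1) * (p : ℚ) ^ j * (-1) ^ j * (j.choose i : ℚ) =
        mhs i (p - 1) * (p : ℚ) ^ i := by
    have h := congrArg (fun P ↦ Polynomial.coeff P i) hpoly
    simpa only [Polynomial.finsetSum_coeff, Polynomial.coeff_C_mul,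
      Polynomial.coeff_one_add_X_pow, Polynomial.coeff_X_pow, mul_ite, mul_one, mul_zero,
      Finset.sum_ite_eq, if_pos hi] using h
  calc _ = ∑ j ∈ Finset.range p, ∑ i ∈ Finset.range p,
        mhs j (p - 1) * (p : ℚ) ^ j * (-1) ^ j * (j.choose i : ℚ) * c i := by
        refine Finset.sum_congr rfl fun j hj ↦ ?_
        have hsub : Finset.range (j + 1) ⊆ Finset.range p :=
          Finset.range_mono (Finset.mem_range.1 hj)
        rw [Finset.sum_subset hsub fun i _ hi ↦ ?_, Finset.mul_sum, Finset.mul_sum]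
        · exact Finset.sum_congr rfl fun i _ ↦ by ring
        · rw [Nat.choose_eq_zero_of_lt (by simpa using hi), Nat.cast_zero, zero_mul]
    _ = _ := by
        rw [Finset.sum_comm]
        exact Finset.sum_congr rfl fun i hi ↦ by rw [← hcoeff i hi, Finset.sum_mul]

theorem choose_mul_prime_sub_one_eq_sum {p : ℕ} (hodd : Odd p) (x : ℚ) (c b : ℕ → ℚ)
    (hb : ∀ j, b j = (x - 1) ^ j + c j +
      (-1 : ℚ) ^ (j + 1) * ∑ i ∈ Finset.range (j + 1), (j.choose i : ℚ) * c i) :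
    Ring.choose (x * p - 1) (p - 1) =
      ∑ j ∈ Finset.range p, b j * (p : ℚ) ^ j * mhs j (p - 1) := by
  rw [choose_mul_prime_sub_one hodd, prod_Icc_one_add_div_eq_sum_mhs,
    Nat.sub_add_cancel hodd.pos]
  rw [← add_zero (∑ j ∈ Finset.range p, mhs j (p - 1) * ((x - 1) * (p : ℚ)) ^ j),
    ← sub_eq_zero.2 (sum_mhs_mul_binomial_transform hodd c).symm, ← Finset.sum_sub_distrib,
    ← Finset.sum_add_distrib]
  refine Finset.sum_congr rfl fun j _ ↦ ?_
  rw [hb, mul_pow]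
  ring

section

variable {p : ℕ} [hp : Fact p.Prime]

/-- The `j`-th elementary symmetric polynomial evaluated at `1, ..., m`. -/
def esymmIcc (m j : ℕ) : ℚ :=
  ((Finset.Icc 1 m).val.map fun i : ℕ ↦ (i : ℚ)).esymm j

theorem prod_Icc_one_natCast_eq_factorial (m : ℕ) :
    ∏ i ∈ Finset.Icc 1 m, (i : ℚ) = m.factorial := by
  rw [← Finset.prod_Ico_id_eq_factorial, Finset.Ico_add_one_right_eq_Icc, Nat.cast_prod]

theorem mhs_mul_factorial {j m : ℕ} (hj : j ≤ m) :
    mhs j m * m.factorial = esymmIcc m (m - j) := by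
  have h := sum_powersetCard_prod_inv_mul_prod (Finset.Icc 1 m) (fun i ↦ (i : ℚ))
    (fun i hi ↦ Nat.cast_ne_zero.2 (Nat.one_le_iff_ne_zero.1 (Finset.mem_Icc.1 hi).1))
    (j := j) (by simpa using hj)
  rwa [Nat.card_Icc, Nat.add_sub_cancel, prod_Icc_one_natCast_eq_factorial] at h

theorem padicDvd_zero_esymmIcc (m j : ℕ) : PadicDvd p 0 (esymmIcc m j) := by
  rw [esymmIcc, Finset.esymm_map_val]
  exact .sum fun t _ ↦ .prod fun i _ ↦ .natCast i

theorem esymmIcc_newton {j : ℕ} (hj : 0 < j) :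
    ∑ i ∈ Finset.range p, (i : ℚ) ^ j = (-1) ^ (j + 1) * j * esymmIcc (p - 1) j -
      ∑ a ∈ Finset.HasAntidiagonal.antidiagonal j with a.1 ∈ Set.Ioo 0 j,
        (-1) ^ a.1 * esymmIcc (p - 1) a.1 * ∑ i ∈ Finset.range p, (i : ℚ) ^ a.2 := by
  rw [← sum_Icc_pow_eq_sum_range_pow hj hp.out.pos,
    sum_pow_eq_mul_esymm_sub_sum (Finset.Icc 1 (p - 1)) (fun i ↦ (i : ℚ)) hj]
  refine congrArg₂ _ rfl (Finset.sum_congr rfl fun a ha ↦ ?_)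
  simp only [Finset.mem_filter, Finset.HasAntidiagonal.mem_antidiagonal, Set.mem_Ioo] at ha
  rw [sum_Icc_pow_eq_sum_range_pow (by omega) hp.out.pos, esymmIcc]

theorem padicDvd_esymmIcc {j : ℕ} (hj : 0 < j) (hjp : j + 2 ≤ p) :
    PadicDvd p 1 (esymmIcc (p - 1) j) := by
  have hsum : PadicDvd p 1
      (∑ a ∈ Finset.HasAntidiagonal.antidiagonal j with a.1 ∈ Set.Ioo 0 j,
        (-1) ^ a.1 * esymmIcc (p - 1) a.1 * ∑ i ∈ Finset.range p, (i : ℚ) ^ a.2) := by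
    refine .sum fun a ha ↦ ?_
    simp only [Finset.mem_filter, Finset.HasAntidiagonal.mem_antidiagonal, Set.mem_Ioo] at ha
    exact ((PadicDvd.neg_one_pow _).mul (padicDvd_zero_esymmIcc _ _)).mul_left
      (.sum_pow (by omega))
  have h := (PadicDvd.neg_one_pow (p := p) (j + 1)).mul_left
    ((PadicDvd.sum_pow (p := p) hjp).add hsum)
  rw [esymmIcc_newton hj, sub_add_cancel, ← mul_assoc, ← mul_assoc, ← mul_pow, neg_one_mul,
    neg_neg, one_pow, one_mul] at h
  exact h.of_natCast_mul hj (by omega)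

theorem padicDvd_mul_esymmIcc_add_bernoulli {j : ℕ} (hj : 0 < j) (heven : Even j)
    (hjp : j + 2 ≤ p) :
    PadicDvd p 2 (j * esymmIcc (p - 1) j + p * _root_.bernoulli j) := by
  have hsum : PadicDvd p 2
      (∑ a ∈ Finset.HasAntidiagonal.antidiagonal j with a.1 ∈ Set.Ioo 0 j,
        (-1) ^ a.1 * esymmIcc (p - 1) a.1 * ∑ i ∈ Finset.range p, (i : ℚ) ^ a.2) := by
    refine .sum fun a ha ↦ ?_
    simp only [Finset.mem_filter, Finset.HasAntidiagonal.mem_antidiagonal, Set.mem_Ioo] at ha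
    exact ((PadicDvd.neg_one_pow _).mul_left (padicDvd_esymmIcc (by omega) (by omega))).mul
      (.sum_pow (by omega))
  have h := (PadicDvd.sum_pow_sub_bernoulli (p := p) hjp).add hsum
  rw [esymmIcc_newton hj, heven.add_one.neg_one_pow] at h
  have h0 : PadicDvd p 2 0 := by simp [PadicDvd]
  convert h0.sub h using 1
  ring

theorem PadicDvd.inv_factorial_prime_sub_one : PadicDvd p 0 (((p - 1).factorial : ℚ)⁻¹) := by
  rw [← prod_Icc_one_natCast_eq_factorial, ← Finset.prod_inv_distrib]
  refine .prod fun i hi ↦ .inv_natCast ?_ ?_ <;> rw [Finset.mem_Icc] at hi <;>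
    have := hp.out.pos <;> omega

theorem PadicDvd.factorial_prime_sub_one_add_one :
    PadicDvd p 1 (((p - 1).factorial : ℚ) + 1) := by
  have hdvd : p ∣ (p - 1).factorial + 1 := by
    rw [← ZMod.natCast_eq_zero_iff]
    push_cast
    rw [ZMod.wilsons_lemma, neg_add_cancel]
  obtain ⟨a, ha⟩ := hdvd
  have h := (prime (p := p)).mul_right (natCast a)
  rwa [← Nat.cast_mul, ← ha, Nat.cast_add, Nat.cast_one] at h

theorem mhs_eq_esymmIcc_mul_inv_factorial {j m : ℕ} (hj : j ≤ m) :
    mhs j m = esymmIcc m (m - j) * (m.factorial : ℚ)⁻¹ := by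
  rw [← mhs_mul_factorial hj, mul_inv_cancel_right₀ (mod_cast m.factorial_ne_zero)]

theorem padicDvd_zero_mhs {j : ℕ} (hj : j ≤ p - 1) : PadicDvd p 0 (mhs j (p - 1)) := by
  rw [mhs_eq_esymmIcc_mul_inv_factorial hj]
  exact (padicDvd_zero_esymmIcc _ _).mul .inv_factorial_prime_sub_one

theorem padicDvd_mhs {j : ℕ} (hj : 0 < j) (hjp : j + 2 ≤ p) :
    PadicDvd p 1 (mhs j (p - 1)) := by
  rw [mhs_eq_esymmIcc_mul_inv_factorial (by omega)]
  exact (padicDvd_esymmIcc (by omega) (by omega)).mul_right .inv_factorial_prime_sub_one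

theorem padicDvd_mhs_sub_bernoulli (hodd : Odd p) {j : ℕ} (hj : 0 < j) (heven : Even j)
    (hjp : j + 3 ≤ p) :
    PadicDvd p 2 (mhs j (p - 1) - -_root_.bernoulli (p - 1 - j) / (j + 1) * p) := by
  have hm : Even (p - 1 - j) := (Nat.Odd.sub_odd hodd odd_one).tsub heven
  have hE := padicDvd_mul_esymmIcc_add_bernoulli (p := p) (by omega) hm (by omega)
  have hmhs := padicDvd_mhs (p := p) hj (by omega)
  have hW := (PadicDvd.natCast (p - 1 - j)).mul_left
    ((PadicDvd.factorial_prime_sub_one_add_one (p := p)).mul hmhs)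
  have hcast : ((p - 1 - j : ℕ) : ℚ) = p - 1 - j := by
    rw [Nat.cast_sub (by omega), Nat.cast_sub (by omega), Nat.cast_one]
  rw [← mhs_mul_factorial (by omega)] at hE
  refine PadicDvd.of_natCast_mul (a := j + 1) (by omega) (by omega) ?_
  have h := (hE.sub hW).add (PadicDvd.prime.mul hmhs)
  convert h using 1
  rw [hcast]
  have : (j : ℚ) + 1 ≠ 0 := by positivity
  push_cast
  field_simp
  ring

end

theorem stmt11 (k : ℤ) (c : ℕ → ℚ) (b : ℕ → ℚ)
    (hb : ∀ j, b j = ((k : ℚ) - 1) ^ j + c j +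
      (-1 : ℚ) ^ (j + 1) * ∑ i ∈ Finset.range (j + 1), (j.choose i : ℚ) * c i)
    (p : ℕ) (hp : p.Prime) (hodd : Odd p)
    (hc : ∀ i, 0 ≤ padicValRat p (c i))
    (N : ℕ) (hN : Odd N) (hN1 : 1 ≤ N) (hNp : N + 4 ≤ p) :
    padicNorm p ((Ring.choose ((k : ℚ) * p - 1) (p - 1) -
          ∑ j ∈ Finset.range (N + 1), b j * (p : ℚ) ^ j * mhs j (p - 1)) -
        -(_root_.bernoulli (p - 2 - N)) / ((N : ℚ) + 2) * b (N + 1) * (p : ℚ) ^ (N + 2))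
      ≤ (p : ℚ) ^ (-((N : ℤ) + 3)) := by
  have : Fact p.Prime := ⟨hp⟩
  have hbint (j : ℕ) : PadicDvd p 0 (b j) := by
    have hcint (i : ℕ) : PadicDvd p 0 (c i) := .of_padicValRat_nonneg (hc i)
    have hk : PadicDvd p 0 ((k : ℚ) - 1) := (PadicDvd.intCast k).sub .one
    rw [hb]
    exact ((hk.pow j).add (hcint j)).add ((PadicDvd.neg_one_pow _).mul
      (.sum fun i _ ↦ (PadicDvd.natCast _).mul (hcint i)))
  have htail : PadicDvd p (N + 3)
      (∑ j ∈ Finset.Ico (N + 2) p, b j * (p : ℚ) ^ j * mhs j (p - 1)) := by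
    refine .sum fun j hj ↦ ?_
    obtain ⟨hNj, hjp⟩ := Finset.mem_Ico.1 hj
    have hpow := (hbint j).mul_left (PadicDvd.prime_pow (p := p) j)
    rcases hNj.eq_or_lt with rfl | hlt
    · exact (hpow.mul (padicDvd_mhs (by omega) (by omega))).mono (by omega)
    · exact (hpow.mul_right (padicDvd_zero_mhs (by omega))).mono hlt
  have hmain := ((hbint (N + 1)).mul_left (PadicDvd.prime_pow (p := p) (N + 1))).mul
    (padicDvd_mhs_sub_bernoulli hodd N.succ_pos hN.add_one (by omega))
  have h := htail.add (hmain.mono (m := N + 3) (by omega))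
  rw [show p - 1 - (N + 1) = p - 2 - N by omega] at h
  rw [choose_mul_prime_sub_one_eq_sum hodd k c b hb,
    ← Finset.sum_range_add_sum_Ico _ (show N + 1 ≤ p by omega), add_sub_cancel_left,
    Finset.sum_eq_sum_Ico_succ_bot (by omega)]
  refine (le_of_eq ?_).trans (h.trans_eq ?_)
  · congr 1
    push_cast
    ring
  · push_cast
    rfl
end
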